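/- Given a sequence (aₙ)ₙ with aₙ ∈ [0,1] for all n, there exists a smooth function f : ℝ → ℝ such that f(n) = n - aₙ for all natural numbers n, the local maxima of f are attained exactly at the natural numbers, and f'(x) ∈ [-1, 5] for all x ∈ ℝ. -/

import Mathlib

open Set Filter Topology in
theorem aux_q : ∃ q : ℝ → ℝ, ContDiff ℝ (⊤ : ℕ∞) q ∧ (∀ x, 0 ≤ q x) ∧ (∀ x, q x ≤ 24/10) ∧
    (∀ x, x ≤ 1/2 → q x = 0) ∧ (∀ x, 1 ≤ x → q x = 0) ∧ (∫ x in (0:ℝ)..1, q x) = 1 := by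
  let b : ContDiffBump (3/4 : ℝ) := ⟨22/100, 1/4, by norm_num, by norm_num⟩
  have hz : ∀ x, x ∉ Ioo (1/2 : ℝ) 1 → b.normed MeasureTheory.volume x = 0 := by
    intro x hx
    by_contra h
    have h2 : x ∈ Function.support (b.normed MeasureTheory.volume) := h
    rw [b.support_normed_eq, Real.ball_eq_Ioo] at h2
    apply hx
    constructor
    · have := h2.1
      simp only [b] at this; linarith
    · have := h2.2
      simp only [b] at this; linarith
  refine ⟨b.normed MeasureTheory.volume, b.contDiff_normed, b.nonneg_normed, ?_, ?_, ?_, ?_⟩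
  · intro x
    refine (b.normed_le_div_measure_closedBall_rIn MeasureTheory.volume x).trans ?_
    rw [MeasureTheory.measureReal_def, Real.volume_closedBall, ENNReal.toReal_ofReal] <;> norm_num [b]
  · intro x hx
    exact hz x (fun h => by linarith [h.1])
  · intro x hx
    exact hz x (fun h => by linarith [h.2])
  · rw [intervalIntegral.integral_of_le zero_le_one, MeasureTheory.setIntegral_eq_integral_of_forall_compl_eq_zero, b.integral_normed]
    intro x hx
    apply hz
    intro h
    exact hx ⟨by linarith [h.1], h.2.le⟩

theorem aux_prim (q : ℝ → ℝ) (hq : ContDiff ℝ (⊤ : ℕ∞) q) :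
    ∃ s : ℝ → ℝ, ContDiff ℝ (⊤ : ℕ∞) s ∧ (∀ x, HasDerivAt s (q x) x) ∧
      ∀ x, s x = ∫ t in (0:ℝ)..x, q t := by
  have h : ∀ x, HasDerivAt (fun x => ∫ t in (0:ℝ)..x, q t) (q x) x := fun x =>
    hq.continuous.integral_hasStrictDerivAt 0 x |>.hasDerivAt
  refine ⟨fun x => ∫ t in (0:ℝ)..x, q t, ?_, h, fun x => rfl⟩
  rw [contDiff_infty_iff_deriv]
  refine ⟨fun x => (h x).differentiableAt, ?_⟩
  rwa [show deriv (fun x => ∫ t in (0:ℝ)..x, q t) = q from funext fun x => (h x).deriv]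

theorem aux_T (q : ℝ → ℝ) (hq : ContDiff ℝ (⊤ : ℕ∞) q)
    (hl : ∀ x, x ≤ 1/2 → q x = 0) (hr : ∀ x, 1 ≤ x → q x = 0)
    (hI : (∫ x in (0:ℝ)..1, q x) = 1) (c : ℕ → ℝ) :
    ∃ T : ℝ → ℝ, ContDiff ℝ (⊤ : ℕ∞) T ∧
      (∀ x, HasDerivAt T (c ⌊x⌋₊ * q (x - ⌊x⌋₊)) x) ∧
      ∀ n : ℕ, T n = ∑ k ∈ Finset.range n, c k := by
  obtain ⟨s, hs, hd, hsI⟩ := aux_prim q hq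
  have s0 : ∀ x, x ≤ 0 → s x = 0 := by
    intro x hx
    rw [hsI, intervalIntegral.integral_congr (g := fun _ => (0:ℝ))]
    · simp
    · intro t ht
      rw [Set.uIcc_of_ge hx] at ht
      exact hl t (by linarith [ht.2])
  have s1 : ∀ x, 1 ≤ x → s x = 1 := by
    intro x hx
    rw [hsI, ← intervalIntegral.integral_add_adjacent_intervals
      (hq.continuous.intervalIntegrable 0 1) (hq.continuous.intervalIntegrable 1 x), hI,
      intervalIntegral.integral_congr (a := 1) (g := fun _ => (0:ℝ))]
    · simp
    · intro t ht
      rw [Set.uIcc_of_le hx] at ht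
      exact hr t ht.1
  let T : ℝ → ℝ := fun x => ∑ k ∈ Finset.range (⌊x⌋₊ + 1), c k * s (x - k)
  have hT : ∀ (N : ℕ) (x : ℝ), x < N → T x = ∑ k ∈ Finset.range N, c k * s (x - k) := by
    intro N x hx
    rcases Nat.eq_zero_or_pos N with h0 | hN
    · subst h0
      have hx' : x < 0 := by simpa using hx
      simp [T, Nat.floor_of_nonpos hx'.le, s0 x hx'.le]
    apply Finset.sum_subset
    · apply Finset.range_subset_range.2
      exact (Nat.floor_lt' hN.ne').2 hx
    · intro k _ hk
      have : ⌊x⌋₊ < k := by simpa using hk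
      have := Nat.lt_of_floor_lt this
      rw [s0 _ (by linarith), mul_zero]
  have hE : ∀ x : ℝ, T =ᶠ[nhds x] fun y => ∑ k ∈ Finset.range (⌊x⌋₊ + 1), c k * s (y - k) := by
    intro x
    have : x < ((⌊x⌋₊ + 1 : ℕ) : ℝ) := by push_cast; exact Nat.lt_floor_add_one x
    filter_upwards [Iio_mem_nhds this] with y hy
    exact hT _ y hy
  refine ⟨T, ?_, ?_, ?_⟩
  · rw [contDiff_iff_contDiffAt]
    intro x
    refine ContDiffAt.congr_of_eventuallyEq ?_ (hE x)
    apply ContDiff.contDiffAt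
    fun_prop
  · intro x
    refine HasDerivAt.congr_of_eventuallyEq ?_ (hE x)
    have h1 : HasDerivAt (fun y => ∑ k ∈ Finset.range (⌊x⌋₊ + 1), c k * s (y - k))
        (∑ k ∈ Finset.range (⌊x⌋₊ + 1), c k * q (x - k)) x := by
      apply HasDerivAt.fun_sum
      intro k _
      exact ((hd (x - k)).comp_sub_const x k).const_mul (c k)
    refine h1.congr_deriv ?_
    rw [Finset.sum_range_succ, Finset.sum_eq_zero, zero_add]
    intro k hk
    have hk : k + 1 ≤ ⌊x⌋₊ := by simpa using hk
    have := (Nat.le_floor_iff' (by omega)).1 hk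
    push_cast at this
    rw [hr _ (by linarith), mul_zero]
  · intro n
    rw [hT (n+1) n (by push_cast; linarith), Finset.sum_range_succ, sub_self, s0 0 le_rfl,
      mul_zero, add_zero]
    apply Finset.sum_congr rfl
    intro k hk
    have hk : k + 1 ≤ n := by simpa using hk
    have : ((k + 1 : ℕ) : ℝ) ≤ n := by exact_mod_cast hk
    push_cast at this
    rw [s1 _ (by linarith), mul_one]

theorem aux_sin (n : ℕ) (x : ℝ) : Real.sin (2 * Real.pi * x) = Real.sin (2 * Real.pi * (x - n)) := by
  rw [show 2 * Real.pi * (x - n) = 2 * Real.pi * x - n * (2 * Real.pi) by ring,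
    Real.sin_sub_nat_mul_two_pi]

theorem aux_sin_pos (t : ℝ) (h : 0 < t) (h' : t < 1/2) : 0 < Real.sin (2 * Real.pi * t) := by
  have := Real.pi_pos
  apply Real.sin_pos_of_pos_of_lt_pi
  · positivity
  · nlinarith

theorem aux_sin_neg (t : ℝ) (h : 1/2 < t) (h' : t < 1) : Real.sin (2 * Real.pi * t) < 0 := by
  have := aux_sin_pos (1 - t) (by linarith) (by linarith)
  rw [show 2 * Real.pi * (1 - t) = 2 * Real.pi - 2 * Real.pi * t by ring,
    Real.sin_two_pi_sub] at this
  linarith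

theorem stmt_3 (a : ℕ → ℝ) (ha : ∀ n, a n ∈ Set.Icc (0:ℝ) 1) :
    ∃ f : ℝ → ℝ, ContDiff ℝ (⊤ : ℕ∞) f ∧
      (∀ n : ℕ, f n = n - a n) ∧
      (∀ x : ℝ, IsLocalMax f x ↔ ∃ n : ℕ, x = n) ∧
      (∀ x : ℝ, deriv f x ∈ Set.Icc (-1 : ℝ) 5) := by
  obtain ⟨q, hq, q0, q1, hl, hr, hI⟩ := aux_q
  let c : ℕ → ℝ := fun n => 1 - a (n+1) + a n
  have c0 : ∀ n, 0 ≤ c n := fun n => by have := (ha (n+1)).2; have := (ha n).1; simp only [c]; linarith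
  have c2 : ∀ n, c n ≤ 2 := fun n => by have := (ha (n+1)).1; have := (ha n).2; simp only [c]; linarith
  obtain ⟨T, hT, hTd, hTn⟩ := aux_T q hq hl hr hI c
  have he : ContDiff ℝ (⊤ : ℕ∞) (fun x : ℝ => expNegInvGlue (-x)) :=
    expNegInvGlue.contDiff.comp contDiff_neg
  obtain ⟨E, hE, hEd, hEI⟩ := aux_prim _ he
  let α : ℝ := Real.exp (-2) / 2
  have α0 : 0 < α := by positivity
  have α1 : α ≤ 1/10 := by
    have h1 : Real.exp 2 * Real.exp (-2) = 1 := by rw [← Real.exp_add]; simp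
    have h2 : (5:ℝ) ≤ Real.exp 2 := by
      have := Real.quadratic_le_exp_of_nonneg (x := 2) (by norm_num); linarith
    have := Real.exp_pos (-2)
    simp only [α]; nlinarith
  have hpi := Real.pi_pos
  let f : ℝ → ℝ := fun x => α / (2 * Real.pi) * (Real.cos (2 * Real.pi * x) - 1) + E x + T x - a 0
  let G : ℝ → ℝ := fun x => - α * Real.sin (2 * Real.pi * x) + expNegInvGlue (-x)
    + c ⌊x⌋₊ * q (x - ⌊x⌋₊)
  have hfd : ∀ x, HasDerivAt f (G x) x := by
    intro x
    have h1 : HasDerivAt (fun x => 2 * Real.pi * x) (2 * Real.pi) x := by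
      simpa using (hasDerivAt_id x).const_mul (2 * Real.pi)
    have h2 := ((h1.cos.sub_const 1).const_mul (α / (2 * Real.pi)))
    have h3 : HasDerivAt f _ x := ((h2.add (hEd x)).add (hTd x)).sub_const (a 0)
    refine h3.congr_deriv ?_
    simp only [G]
    field_simp
  have hfc : ContDiff ℝ (⊤ : ℕ∞) f := by
    simp only [f]
    fun_prop
  have hderiv : ∀ x, deriv f x = G x := fun x => (hfd x).deriv
  -- glue facts
  have e0 : ∀ x : ℝ, 0 ≤ x → expNegInvGlue (-x) = 0 := fun x hx =>
    expNegInvGlue.zero_of_nonpos (by linarith)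
  have e1 : ∀ x : ℝ, expNegInvGlue x ≤ 1 := by
    intro x
    unfold expNegInvGlue
    split_ifs with h
    · norm_num
    · apply Real.exp_le_one_iff.2
      have : 0 ≤ x⁻¹ := by push Not at h; positivity
      linarith
  have floorn : ∀ (n : ℕ) (x : ℝ), (n:ℝ) ≤ x → x < n + 1 → ⌊x⌋₊ = n := by
    intro n x h1 h2
    exact (Nat.floor_eq_iff (le_trans (Nat.cast_nonneg n) h1)).2 ⟨h1, h2⟩
  have Gn : ∀ (n : ℕ) (x : ℝ), (n:ℝ) ≤ x → x < n + 1 →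
      G x = - α * Real.sin (2 * Real.pi * (x - n)) + c n * q (x - n) := by
    intro n x h1 h2
    simp only [G]
    rw [floorn n x h1 h2, e0 x (le_trans (Nat.cast_nonneg n) h1), aux_sin n x, add_zero]
  have Gneg : ∀ x, x < 0 → G x = - α * Real.sin (2 * Real.pi * x) + expNegInvGlue (-x) := by
    intro x hx
    simp only [G]
    rw [Nat.floor_of_nonpos hx.le, hl _ (by simp; linarith)]
    simp
  have P0 : ∀ x, x < 0 → 0 < G x := by
    intro x hx
    rw [Gneg x hx]
    by_cases h : -x < 1/2
    · have h1 := aux_sin_pos (-x) (by linarith) h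
      rw [show 2 * Real.pi * (-x) = - (2 * Real.pi * x) by ring, Real.sin_neg] at h1
      have := expNegInvGlue.nonneg (-x)
      nlinarith
    · have h2 : 2 * α ≤ expNegInvGlue (-x) := by
        have hh : 0 < -x := by linarith
        simp only [expNegInvGlue, α, if_neg (not_le.2 hh)]
        have : Real.exp (-2) ≤ Real.exp (-(-x)⁻¹) := by
          apply Real.exp_le_exp.2
          have : (-x)⁻¹ ≤ (1/2)⁻¹ := by
            apply inv_anti₀ <;> linarith
          norm_num at this ⊢
          linarith
        linarith
      have := Real.sin_le_one (2 * Real.pi * x)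
      nlinarith
  have P1 : ∀ (n : ℕ) (x : ℝ), (n:ℝ) < x → x < n + 1/2 → G x < 0 := by
    intro n x h1 h2
    rw [Gn n x h1.le (by linarith), hl _ (by linarith)]
    have := aux_sin_pos (x - n) (by linarith) (by linarith)
    nlinarith
  have P2 : ∀ (n : ℕ) (x : ℝ), (n:ℝ) + 1/2 < x → x < n + 1 → 0 < G x := by
    intro n x h1 h2
    rw [Gn n x (by linarith) (by linarith)]
    have := aux_sin_neg (x - n) (by linarith) (by linarith)
    have := mul_nonneg (c0 n) (q0 (x - n))
    nlinarith
  refine ⟨f, hfc, ?_, ?_, ?_⟩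
  · intro n
    have hE0 : E n = 0 := by
      rw [hEI, intervalIntegral.integral_congr (g := fun _ => (0:ℝ))]
      · simp
      · intro t ht
        rw [Set.uIcc_of_le (Nat.cast_nonneg n)] at ht
        exact e0 t ht.1
    have hS : ∀ n : ℕ, ∑ k ∈ Finset.range n, c k = n - a n + a 0 := by
      intro n
      induction n with
      | zero => simp
      | succ k ih => rw [Finset.sum_range_succ, ih]; simp only [c]; push_cast; ring
    simp only [f]
    rw [hE0, hTn, hS, mul_comm (2 * Real.pi), Real.cos_nat_mul_two_pi]
    ring
  · intro x
    constructor
    · intro hx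
      have hG : G x = 0 := by rw [← hderiv]; exact hx.deriv_eq_zero
      have hx0 : 0 ≤ x := by
        by_contra h
        have := P0 x (by linarith)
        linarith
      have hn1 := Nat.floor_le hx0
      have hn2 := Nat.lt_floor_add_one x
      refine ⟨⌊x⌋₊, ?_⟩
      generalize ⌊x⌋₊ = n at hn1 hn2
      by_contra hne
      have hn1 : (n:ℝ) < x := lt_of_le_of_ne hn1 (Ne.symm hne)
      rcases lt_trichotomy x (n + 1/2) with h | h | h
      · have := P1 n x hn1 h
        linarith
      · have hm : StrictMonoOn f (Set.Icc x (n+1)) := by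
          apply strictMonoOn_of_deriv_pos (convex_Icc _ _) hfc.continuous.continuousOn
          intro y hy
          rw [interior_Icc] at hy
          rw [hderiv]
          exact P2 n y (by linarith [hy.1]) hy.2
        have h1 : ∀ᶠ y in nhdsWithin x (Set.Ioi x), f y ≤ f x := hx.filter_mono nhdsWithin_le_nhds
        obtain ⟨y, hy, hy2⟩ := (h1.and (Ioo_mem_nhdsGT hn2)).exists
        have := hm ⟨le_rfl, hn2.le⟩ ⟨hy2.1.le, hy2.2.le⟩ hy2.1
        linarith
      · have := P2 n x h hn2
        linarith
    · rintro ⟨n, rfl⟩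
      apply isLocalMax_of_deriv hfc.continuous.continuousAt
      · exact Filter.Eventually.of_forall fun y => (hfd y).differentiableAt
      · have : (n:ℝ) - 1/2 < n := by linarith
        filter_upwards [Ioo_mem_nhdsLT this] with y hy
        rw [hderiv]
        rcases n with _ | m
        · exact (P0 y (by simpa using hy.2)).le
        · have h1 := hy.1
          have h2 := hy.2
          push_cast at h1 h2
          exact (P2 m y (by linarith) h2).le
      · have : (n:ℝ) < n + 1/2 := by linarith
        filter_upwards [Ioo_mem_nhdsGT this] with y hy
        rw [hderiv]
        exact (P1 n y hy.1 hy.2).le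
  · intro x
    rw [hderiv]
    have hs1 := Real.sin_le_one (2 * Real.pi * x)
    have hs2 := Real.neg_one_le_sin (2 * Real.pi * x)
    rcases lt_or_ge x 0 with h | h
    · refine ⟨by linarith [P0 x h], ?_⟩
      rw [Gneg x h]
      have := e1 (-x)
      nlinarith
    · simp only [G]
      rw [e0 x h]
      have h1 := mul_nonneg (c0 ⌊x⌋₊) (q0 (x - ⌊x⌋₊))
      have h2 : c ⌊x⌋₊ * q (x - ⌊x⌋₊) ≤ 2 * (24/10) :=
        mul_le_mul (c2 _) (q1 _) (q0 _) (by norm_num)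
      constructor <;> nlinarith
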